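/- Let V be a real normed vector space and let c₀ > 0, c₁ > 0. Let C ⊆ ℝ × V × ℝ be a convex cone (convex and closed under multiplication by positive scalars) containing the set {(−c₁·‖x‖² − d, x, 1) : x ∈ V, d ≥ c₀}. Then the point (−2c₀, 0, 1) lies in the topological interior of C; indeed the open set {(a, x, s) : s > 0 and a < −c₁·‖x‖²/s − c₀·s} is contained in C. -/

import Mathlib

/-- Step in the proof of Proposition 2.15: a convex cone in `ℝ × V × ℝ` containing
`{(−c₁‖x‖² − d, x, 1) : x ∈ V, d ≥ c₀}` contains the open set
`{(a, x, s) : s > 0, a < −c₁‖x‖²/s − c₀s}`; in particular `(−2c₀, 0, 1)` lies in the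
interior of the cone. -/
theorem stmt5 {V : Type*} [NormedAddCommGroup V] [NormedSpace ℝ V]
    (c₀ c₁ : ℝ) (hc₀ : 0 < c₀) (hc₁ : 0 < c₁)
    (C : Set (ℝ × V × ℝ)) (hconv : Convex ℝ C)
    (hcone : ∀ x ∈ C, ∀ t : ℝ, 0 < t → t • x ∈ C)
    (hsub : ∀ (x : V) (d : ℝ), c₀ ≤ d → ((-c₁ * ‖x‖ ^ 2 - d, x, 1) : ℝ × V × ℝ) ∈ C) :
    {p : ℝ × V × ℝ | 0 < p.2.2 ∧ p.1 < -c₁ * ‖p.2.1‖ ^ 2 / p.2.2 - c₀ * p.2.2} ⊆ C ∧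
      ((-2 * c₀, 0, 1) : ℝ × V × ℝ) ∈ interior C := by
  have hC : {p : ℝ × V × ℝ | 0 < p.2.2 ∧ p.1 < -c₁ * ‖p.2.1‖ ^ 2 / p.2.2 - c₀ * p.2.2} ⊆ C := by
    rintro ⟨a, x, s⟩ ⟨hs, ha⟩
    dsimp only at hs ha
    have hd : c₀ ≤ -c₁ * ‖s⁻¹ • x‖ ^ 2 - a / s := by
      rw [norm_smul, norm_inv, Real.norm_of_nonneg hs.le]
      have h := div_le_div_of_nonneg_right ha.le hs.le
      have e : (-c₁ * ‖x‖ ^ 2 / s - c₀ * s) / s = -c₁ * (s⁻¹ * ‖x‖) ^ 2 - c₀ := by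
        field_simp
      linarith
    convert hcone _ (hsub (s⁻¹ • x) _ hd) s hs using 1
    ext
    · simp only [Prod.smul_fst, smul_eq_mul, sub_sub_cancel]
      field_simp
    · simp [smul_smul, hs.ne']
    · simp
  refine ⟨hC, mem_interior_iff_mem_nhds.2 (Filter.mem_of_superset ?_ hC)⟩
  refine Filter.Eventually.and ?_ ?_
  · exact (continuous_const.continuousAt).eventually_lt
      (continuous_snd.snd.continuousAt) (by simp)
  · refine ContinuousAt.eventually_lt (by fun_prop) ?_ ?_
    · exact ContinuousAt.sub (ContinuousAt.div (by fun_prop) (by fun_prop) (by simp))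
        (by fun_prop)
    · simp only [norm_zero]
      linarith
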